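/- Let M and b be positive integers and set N = M·b. Then, as real numbers, the binomial coefficient C(N − b, M) satisfies C(N − b, M) ≤ e^{−1} · C(N, M), where e is Euler's number. -/

import Mathlib

theorem Nat.descFactorial_mul_pow_le {m n p q : ℕ} (hpq : p ≤ q) (h : n * q ≤ p * m) (k : ℕ) :
    n.descFactorial k * q ^ k ≤ p ^ k * m.descFactorial k := by
  induction k with
  | zero => simp
  | succ k ih =>
    have hk : (n - k) * q ≤ p * (m - k) := by
      rw [Nat.sub_mul, Nat.mul_sub, Nat.mul_comm p k]
      exact tsub_le_tsub h (Nat.mul_le_mul_left k hpq)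
    calc n.descFactorial (k + 1) * q ^ (k + 1)
        = ((n - k) * q) * (n.descFactorial k * q ^ k) := by
          rw [Nat.descFactorial_succ]; ring
      _ ≤ (p * (m - k)) * (p ^ k * m.descFactorial k) := Nat.mul_le_mul hk ih
      _ = p ^ (k + 1) * m.descFactorial (k + 1) := by
          rw [Nat.descFactorial_succ]; ring

theorem Nat.choose_mul_pow_le {m n p q : ℕ} (hpq : p ≤ q) (h : n * q ≤ p * m) (k : ℕ) :
    n.choose k * q ^ k ≤ p ^ k * m.choose k := by
  have hd := Nat.descFactorial_mul_pow_le hpq h k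
  rw [Nat.descFactorial_eq_factorial_mul_choose, Nat.descFactorial_eq_factorial_mul_choose,
    Nat.mul_assoc, Nat.mul_left_comm (p ^ k)] at hd
  exact Nat.le_of_mul_le_mul_left hd k.factorial_pos

theorem stmt1 (M b N : ℕ) (hM : 0 < M) (hb : 0 < b) (hN : N = M * b) :
    ((N - b).choose M : ℝ) ≤ Real.exp (-1) * (N.choose M : ℝ) := by
  have hle : (N - b) * M ≤ (M - 1) * N := by
    subst hN
    rw [Nat.sub_mul, Nat.sub_mul, one_mul, Nat.mul_comm (M * b) M, Nat.mul_comm b M]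
  have hchoose : ((N - b).choose M : ℝ) * (M : ℝ) ^ M ≤ ((M : ℝ) - 1) ^ M * N.choose M := by
    have h := Nat.choose_mul_pow_le (Nat.sub_le M 1) hle M
    rw [← Nat.cast_pred hM]
    exact_mod_cast h
  have hM' : (0 : ℝ) < M := Nat.cast_pos.mpr hM
  calc ((N - b).choose M : ℝ)
      ≤ ((M : ℝ) - 1) ^ M * N.choose M / (M : ℝ) ^ M := (le_div_iff₀ (pow_pos hM' M)).mpr hchoose
    _ = (1 - 1 / (M : ℝ)) ^ M * N.choose M := by
      rw [one_sub_div hM'.ne', div_pow, div_mul_eq_mul_div]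
    _ ≤ Real.exp (-1) * N.choose M := by
      gcongr
      exact Real.one_sub_div_pow_le_exp_neg (Nat.one_le_cast.mpr hM)
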